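/- arXiv:2407.08301 — 2 statements merged into one kernel-verified Lean document; each statement's English description precedes it below -/
import Mathlib

section
/- Let G = (V, E) be a block graph with |V| ≥ 3 and boundary δΩ, and let D be the maximum degree of G. Then the maximum size B of the blocks of G satisfies B ≤ D + 1, and consequently λ₂(G, δΩ) ≤ (D + 1)² (D − 1) / |δΩ|. -/
open Finset

variable {V : Type*}

/-- The Dirichlet energy `∑_{{x,y} ∈ E} (f(x) - f(y))²` of a function on the vertices. -/
noncomputable def graphEnergy [Fintype V] (G : SimpleGraph V) (f : V → ℝ) : ℝ :=
  ∑ e ∈ G.edgeSet.toFinite.toFinset,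
    Sym2.lift ⟨fun x y => (f x - f y) ^ 2, fun _ _ => by ring⟩ e

/-- The first non-trivial Steklov eigenvalue `λ₂(G, δΩ)`. -/
noncomputable def steklovLambda2 [Fintype V] (G : SimpleGraph V) (B : Finset V) : ℝ :=
  sInf {r | ∃ f : V → ℝ, ∑ x ∈ B, f x = 0 ∧ (∃ x ∈ B, f x ≠ 0) ∧
    r = graphEnergy G f / ∑ x ∈ B, f x ^ 2}

/-- A set `S` of at least two vertices induces a connected subgraph without cut vertices
(for `|S| ≥ 3` this is 2-connectedness; a single edge also qualifies). -/
def HasNoCutVertex (G : SimpleGraph V) (S : Set V) : Prop :=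
  2 ≤ S.ncard ∧ (G.induce S).Connected ∧ ∀ v ∈ S, (G.induce (S \ {v})).Connected

/-- `S` is the vertex set of a block of `G`: a maximal 2-connected subgraph
(a single edge with its two endpoints counts as a block). -/
def IsBlockOf (G : SimpleGraph V) (S : Set V) : Prop :=
  HasNoCutVertex G S ∧ ∀ T : Set V, S ⊆ T → HasNoCutVertex G T → T = S

/-- A block graph is a connected graph in which every block is a complete graph. -/
def IsBlockGraph (G : SimpleGraph V) : Prop :=
  G.Connected ∧ ∀ S : Set V, IsBlockOf G S → ∀ x ∈ S, ∀ y ∈ S, x ≠ y → G.Adj x y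

/-- Testing the Rayleigh quotient with the indicator of a set `A`, all of whose outgoing edges
lead from a finite set `N` to a single vertex `c`. -/
theorem steklovLambda2_le_of_cut [Fintype V] (G : SimpleGraph V) (bd : Finset V) (A : Set V)
    [DecidablePred (· ∈ A)] (c : V) (N : Finset V) (hcut : ∀ p q, G.Adj p q → p ∈ A → q ∉ A → q = c ∧ p ∈ N)
    (hpos : 0 < #{z ∈ bd | z ∈ A}) (hlt : #{z ∈ bd | z ∈ A} < #bd) :
    steklovLambda2 G bd ≤
      #N * #bd / (#{z ∈ bd | z ∈ A} * ((#bd : ℝ) - #{z ∈ bd | z ∈ A})) := by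
  classical
  set a := #{z ∈ bd | z ∈ A} with ha
  set n := #bd with hn
  have hn0 : (0 : ℝ) < n := by exact_mod_cast hpos.trans hlt
  have ha0 : (0 : ℝ) < a := by exact_mod_cast hpos
  have han : (a : ℝ) < n := by exact_mod_cast hlt
  set f : V → ℝ := fun z => (if z ∈ A then 1 else 0) - a / n with hf
  have hind : ∑ z ∈ bd, (if z ∈ A then (1 : ℝ) else 0) = a := by
    rw [Finset.sum_boole]
  have hsum : ∑ z ∈ bd, f z = 0 := by
    simp only [hf, Finset.sum_sub_distrib, hind, Finset.sum_const, nsmul_eq_mul, ← hn]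
    field_simp
    ring
  have hsq : ∑ z ∈ bd, f z ^ 2 = a * (n - a) / n := by
    have h : ∀ z ∈ bd, f z ^ 2 =
        (if z ∈ A then (1 : ℝ) else 0) * (1 - 2 * (a / n)) + (a / n) ^ 2 := by
      intro z _
      simp only [hf]
      split_ifs <;> ring
    rw [Finset.sum_congr rfl h, Finset.sum_add_distrib, ← Finset.sum_mul, hind,
      Finset.sum_const, nsmul_eq_mul, ← hn]
    field_simp
    ring
  have hne : ∃ z ∈ bd, f z ≠ 0 := by
    by_contra! h
    have h0 : ∑ z ∈ bd, f z ^ 2 = 0 := Finset.sum_eq_zero fun z hz => by rw [h z hz]; ring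
    have : 0 < (a : ℝ) * (n - a) / n := by
      have := sub_pos.2 han
      positivity
    linarith
  have henergy : graphEnergy G f ≤ #N := by
    have h : ∀ e ∈ G.edgeSet.toFinite.toFinset,
        Sym2.lift ⟨fun x y => (f x - f y) ^ 2, fun _ _ => by ring⟩ e ≤
          if e ∈ N.image (fun p => s(p, c)) then (1 : ℝ) else 0 := by
      intro e he
      induction e with | _ p q => ?_
      have hadj : G.Adj p q := by simpa using he
      simp only [Sym2.lift_mk, hf]
      by_cases hp : p ∈ A <;> by_cases hq : q ∈ A
      · simp only [hp, hq, if_true, sub_self]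
        split_ifs <;> norm_num
      · obtain ⟨rfl, hpN⟩ := hcut p q hadj hp hq
        rw [if_pos (Finset.mem_image_of_mem _ hpN)]
        simp [hp, hq]
      · obtain ⟨rfl, hqN⟩ := hcut q p hadj.symm hq hp
        rw [if_pos (show s(p, q) ∈ N.image _ from Finset.mem_image.2 ⟨q, hqN, Sym2.eq_swap⟩)]
        simp only [hp, hq, if_true, if_false]
        ring_nf
        rfl
      · simp only [hp, hq, if_false, sub_self]
        split_ifs <;> norm_num
    refine (Finset.sum_le_sum h).trans ?_
    rw [Finset.sum_boole]
    exact_mod_cast (Finset.card_le_card fun e he => (Finset.mem_filter.1 he).2).trans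
      Finset.card_image_le
  have hbdd : BddBelow {r | ∃ f : V → ℝ, ∑ x ∈ bd, f x = 0 ∧ (∃ x ∈ bd, f x ≠ 0) ∧
      r = graphEnergy G f / ∑ x ∈ bd, f x ^ 2} := by
    refine ⟨0, ?_⟩
    rintro r ⟨g, -, -, rfl⟩
    refine div_nonneg (Finset.sum_nonneg fun e _ => ?_)
      (Finset.sum_nonneg fun _ _ => sq_nonneg _)
    induction e with | _ p q => exact sq_nonneg _
  refine (csInf_le hbdd ⟨f, hsum, hne, rfl⟩).trans ?_
  rw [hsq]
  have hna := sub_pos.2 han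
  calc graphEnergy G f / (a * (n - a) / n) ≤ #N / (a * (n - a) / n) := by gcongr
    _ = #N * n / (a * (n - a)) := by field_simp

theorem induce_connected_of_walks (G : SimpleGraph V) {T : Set V} {b : V} (hb : b ∈ T)
    (h : ∀ z ∈ T, ∃ r : G.Walk b z, ∀ t ∈ r.support, t ∈ T) : (G.induce T).Connected := by
  refine SimpleGraph.induce_connected_of_patches b hb fun {z} hz => ?_
  obtain ⟨r, hr⟩ := h z hz
  exact ⟨T, subset_rfl, hb, hz, ⟨r.induce T hr⟩⟩

/-- In a block graph, two neighbours of `v` that are joined by a walk avoiding `v`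
are adjacent. -/
theorem IsBlockGraph.adj_of_walk [Finite V] {G : SimpleGraph V} (hG : IsBlockGraph G)
    {v x y : V} (hx : G.Adj v x) (hy : G.Adj v y) (hxy : x ≠ y) (p : G.Walk x y)
    (hp : v ∉ p.support) : G.Adj x y := by
  classical
  set q := p.bypass with hq
  have hpath : q.IsPath := p.bypass_isPath
  have hvq : v ∉ q.support := fun h => hp (p.support_bypass_subset_support h)
  set S : Set V := insert v {z | z ∈ q.support} with hS
  have hxS : x ∈ S := Or.inr q.start_mem_support
  have hyS : y ∈ S := Or.inr q.end_mem_support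
  have hfrom : ∀ w, w ≠ v → ∀ z ∈ S, z ≠ w → ∃ r : G.Walk v z,
      ∀ t ∈ r.support, t ∈ S ∧ t ≠ w := by
    intro w hw z hz hzw
    rcases hz with rfl | hz
    · refine ⟨.nil, fun t ht => ?_⟩
      obtain rfl : t = z := by simpa using ht
      exact ⟨Or.inl rfl, hzw⟩
    · have hz : z ∈ q.support := hz
      by_cases hwt : w ∈ (q.takeUntil z hz).support
      · have hwd : w ∉ (q.dropUntil z hz).support := by
          intro hwd
          have hnd := hpath.support_nodup
          rw [← q.take_spec hz, SimpleGraph.Walk.support_append] at hnd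
          refine (List.nodup_append.1 hnd).2.2 w hwt w ?_ rfl
          rw [← SimpleGraph.Walk.cons_tail_support] at hwd
          exact (List.mem_cons.1 hwd).resolve_left hzw.symm
        refine ⟨.cons hy (q.dropUntil z hz).reverse, fun t ht => ?_⟩
        rw [SimpleGraph.Walk.support_cons, List.mem_cons,
          SimpleGraph.Walk.support_reverse, List.mem_reverse] at ht
        rcases ht with rfl | ht
        · exact ⟨Or.inl rfl, hw.symm⟩
        · exact ⟨Or.inr (q.support_dropUntil_subset_support hz ht), fun h => hwd (h ▸ ht)⟩
      · refine ⟨.cons hx (q.takeUntil z hz), fun t ht => ?_⟩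
        rw [SimpleGraph.Walk.support_cons, List.mem_cons] at ht
        rcases ht with rfl | ht
        · exact ⟨Or.inl rfl, hw.symm⟩
        · exact ⟨Or.inr (q.support_takeUntil_subset_support hz ht), fun h => hwt (h ▸ ht)⟩
  have hcut : ∀ w ∈ S, (G.induce (S \ {w})).Connected := by
    intro w hwS
    by_cases hw : w = v
    · subst hw
      refine induce_connected_of_walks G (b := x) ⟨hxS, hx.ne'⟩ fun z hz => ?_
      have hz' : z ∈ q.support := hz.1.resolve_left hz.2
      refine ⟨q.takeUntil z hz', fun t ht => ?_⟩
      have := q.support_takeUntil_subset_support hz' ht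
      exact ⟨Or.inr this, fun h => hvq ((show t = w from h) ▸ this)⟩
    · refine induce_connected_of_walks G (b := v) ⟨Or.inl rfl, fun h => hw h.symm⟩
        fun z hz => ?_
      exact hfrom w hw z hz.1 hz.2
  have hconn : (G.induce S).Connected := by
    refine induce_connected_of_walks G (b := x) hxS fun z hz => ?_
    rcases hz with rfl | hz
    · refine ⟨.cons hx.symm .nil, fun t ht => ?_⟩
      simp only [SimpleGraph.Walk.support_cons, SimpleGraph.Walk.support_nil, List.mem_cons,
        List.not_mem_nil, or_false] at ht
      rcases ht with rfl | rfl
      · exact hxS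
      · exact Or.inl rfl
    · exact ⟨q.takeUntil z hz,
        fun t ht => Or.inr (q.support_takeUntil_subset_support hz ht)⟩
  have hS2 : HasNoCutVertex G S :=
    ⟨(Set.one_lt_ncard (Set.toFinite S)).2 ⟨v, Or.inl rfl, x, hxS, hx.ne⟩, hconn, hcut⟩
  obtain ⟨T, hST, hT⟩ := (Set.toFinite {T | HasNoCutVertex G T}).exists_le_maximal hS2
  have hblock : IsBlockOf G T :=
    ⟨hT.prop, fun U hTU hU => (hT.le_of_ge hU hTU).antisymm hTU⟩
  exact hG.2 T hblock x (hST hxS) y (hST hyS) hxy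

/-- The vertices that can be reached from `u` without passing through `v`. -/
def branch (G : SimpleGraph V) (v u : V) : Set V :=
  {z | ∃ p : G.Walk u z, v ∉ p.support}

theorem notMem_branch (G : SimpleGraph V) (v u : V) : v ∉ branch G v u :=
  fun ⟨p, hp⟩ => hp p.end_mem_support

theorem mem_branch_of_walk {G : SimpleGraph V} {v u x z : V} (hx : x ∈ branch G v u)
    (q : G.Walk x z) (hq : v ∉ q.support) : z ∈ branch G v u := by
  obtain ⟨p, hp⟩ := hx
  refine ⟨p.append q, fun h => ?_⟩
  rcases (SimpleGraph.Walk.mem_support_append_iff _ _).1 h with h | h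
  exacts [hp h, hq h]

theorem mem_branch_of_adj {G : SimpleGraph V} {v u x z : V} (hx : x ∈ branch G v u)
    (h : G.Adj x z) (hz : z ≠ v) : z ∈ branch G v u := by
  refine mem_branch_of_walk hx (.cons h .nil) ?_
  simp only [SimpleGraph.Walk.support_cons, SimpleGraph.Walk.support_nil, List.mem_cons,
    List.not_mem_nil, or_false, not_or]
  exact ⟨fun h => notMem_branch G v u (h ▸ hx), hz.symm⟩

/-- In a block graph, the branch at `x` through `w`, where `x` is a neighbour of `v` in a branch
at `v` and `w` is a neighbour of `x` but not of `v`, does not contain `v`. -/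
theorem IsBlockGraph.notMem_branch [Finite V] {G : SimpleGraph V} (hG : IsBlockGraph G)
    {v x w : V} (hvx : G.Adj v x) (hxw : G.Adj x w) (hwv : w ≠ v) (hvw : ¬ G.Adj v w) :
    v ∉ branch G x w :=
  fun ⟨q, hq⟩ => hvw (hG.adj_of_walk hxw hvx.symm hwv q hq).symm

theorem branch_ssubset_branch {G : SimpleGraph V} {v u x w : V} (hx : x ∈ branch G v u)
    (hxw : G.Adj x w) (hv : v ∉ branch G x w) : branch G x w ⊂ branch G v u := by
  classical
  refine (Set.ssubset_iff_of_subset ?_).2 ⟨x, hx, notMem_branch G x w⟩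
  rintro z ⟨q, hq⟩
  have hvq : v ∉ q.support := fun h =>
    hv ⟨q.takeUntil v h, fun h' => hq (q.support_takeUntil_subset_support h h')⟩
  refine mem_branch_of_walk (mem_branch_of_adj hx hxw ?_) q hvq
  rintro rfl
  exact hvq q.start_mem_support

/-- A vertex of a branch at `v` is either a neighbour `x` of `v`, or it lies in a further branch
at such an `x`, through a vertex that is not adjacent to `v`. -/
theorem exists_branch_of_mem_branch {G : SimpleGraph V} (hG : G.Connected) {v u z : V}
    (hz : z ∈ branch G v u) : ∃ x ∈ branch G v u, G.Adj v x ∧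
      (z = x ∨ ∃ w, G.Adj x w ∧ w ≠ v ∧ ¬ G.Adj v w ∧ z ∈ branch G x w) := by
  obtain ⟨p, hpath, hlen⟩ := hG.exists_path_of_dist v z
  cases p with
  | nil => exact absurd hz (notMem_branch G v u)
  | @cons _ x _ hvx p =>
    rw [SimpleGraph.Walk.cons_isPath_iff] at hpath
    refine ⟨x, mem_branch_of_walk hz p.reverse (by simpa using hpath.2), hvx, ?_⟩
    cases p with
    | nil => exact Or.inl rfl
    | @cons _ w _ hxw p =>
      right
      have h1 := SimpleGraph.Walk.cons_isPath_iff _ _ |>.1 hpath.1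
      refine ⟨w, hxw, ?_, fun hvw => ?_, p, h1.2⟩
      · rintro rfl
        exact hpath.2 (by simp)
      · have := SimpleGraph.dist_le (SimpleGraph.Walk.cons hvw p)
        simp only [SimpleGraph.Walk.length_cons] at this hlen
        omega

theorem IsBlockGraph.adj_of_mem_branch [Finite V] {G : SimpleGraph V} (hG : IsBlockGraph G)
    {v u x y : V} (hx : x ∈ branch G v u) (hy : y ∈ branch G v u) (hvx : G.Adj v x)
    (hvy : G.Adj v y) (hxy : x ≠ y) : G.Adj x y := by
  obtain ⟨p, hp⟩ := hx
  obtain ⟨q, hq⟩ := hy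
  refine hG.adj_of_walk hvx hvy hxy (p.reverse.append q) fun h => ?_
  rcases (SimpleGraph.Walk.mem_support_append_iff _ _).1 h with h | h
  exacts [hp (by simpa using h), hq h]

theorem IsBlockOf.ncard_le [Fintype V] {G : SimpleGraph V} [DecidableRel G.Adj]
    (hG : IsBlockGraph G) {S : Set V} (hS : IsBlockOf G S) : S.ncard ≤ G.maxDegree + 1 := by
  classical
  have h2 := hS.1.1
  obtain ⟨x, hx⟩ : S.Nonempty := Set.nonempty_of_ncard_ne_zero (by omega)
  have hsub : S ⊆ (insert x (G.neighborFinset x) : Finset V) := by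
    intro y hy
    by_cases hxy : x = y
    · simp [hxy]
    · simp [hG.2 S hS x hx y hy hxy]
  calc S.ncard ≤ #(insert x (G.neighborFinset x)) := by
        rw [← Set.ncard_coe_finset]; exact Set.ncard_le_ncard hsub
    _ ≤ #(G.neighborFinset x) + 1 := Finset.card_insert_le _ _
    _ ≤ G.maxDegree + 1 := by
        rw [G.card_neighborFinset_eq_degree]; gcongr; exact G.degree_le_maxDegree x

theorem two_le_maxDegree [Fintype V] {G : SimpleGraph V} [DecidableRel G.Adj]
    (hG : G.Connected) (hV : 3 ≤ Fintype.card V) : 2 ≤ G.maxDegree := by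
  classical
  by_contra! h
  have h1 := hG.card_vert_le_card_edgeSet_add_one
  have h2 := G.sum_degrees_eq_twice_card_edges
  have h3 : ∑ v, G.degree v ≤ ∑ _v : V, 1 :=
    Finset.sum_le_sum fun v _ => by have := G.degree_le_maxDegree v; omega
  rw [Nat.card_eq_fintype_card, Nat.card_eq_fintype_card, ← SimpleGraph.edgeFinset_card] at h1
  simp only [Finset.sum_const, Finset.card_univ, smul_eq_mul, mul_one] at h3
  omega

theorem four_mul_mul_sq_le {k m D : ℝ} (hk : 0 ≤ k) (hm : 0 ≤ m) (h : m + k ≤ D) (hD : 2 ≤ D) :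
    4 * k * m ^ 2 ≤ (D + 1) ^ 2 * (D - 1) := by
  have h1 : 27 * (k * m ^ 2) ≤ 4 * (m + k) ^ 3 := by
    have : 0 ≤ (m - 2 * k) ^ 2 * (4 * m + k) := by positivity
    nlinarith
  have h2 : (m + k) ^ 3 ≤ D ^ 3 := by gcongr
  have h3 : 0 ≤ D ^ 3 := by positivity
  nlinarith

open Classical in
/-- A block graph with at least three boundary leaves has a branch at some vertex `x` that holds
a controlled share of the boundary and is cut off by few edges. -/
theorem IsBlockGraph.exists_branch [Fintype V] {G : SimpleGraph V} [DecidableRel G.Adj]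
    (hG : IsBlockGraph G) {bd : Finset V} (hleaf : ∀ x ∈ bd, G.degree x = 1)
    (hbd : 3 ≤ #bd) :
    ∃ (x w : V) (N : Finset V) (k : ℕ),
      #N + k ≤ G.maxDegree ∧ 2 * #{z ∈ bd | z ∈ branch G x w} < #bd ∧
      #bd ≤ 2 * k * (G.maxDegree - k) * #{z ∈ bd | z ∈ branch G x w} ∧
      ∀ p q, G.Adj p q → p ∈ branch G x w → q ∉ branch G x w → q = x ∧ p ∈ N := by
  set D := G.maxDegree with hD
  set P : Finset (V × V) :=
    {t | G.Adj t.1 t.2 ∧ #bd ≤ 2 * #{z ∈ bd | z ∈ branch G t.1 t.2}} with hP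
  have hPne : P.Nonempty := by
    obtain ⟨v, hv⟩ : bd.Nonempty := Finset.card_pos.1 (by omega)
    obtain ⟨u, hu⟩ := (G.degree_pos_iff_exists_adj v).1 (by rw [hleaf v hv]; norm_num)
    refine ⟨(v, u), ?_⟩
    simp only [hP, Finset.mem_filter, Finset.mem_univ, true_and]
    refine ⟨hu, ?_⟩
    have : bd.erase v ⊆ {z ∈ bd | z ∈ branch G v u} := by
      intro z hz
      rw [Finset.mem_erase] at hz
      refine Finset.mem_filter.2 ⟨hz.2, ?_⟩
      obtain ⟨p, hp⟩ := hG.1.exists_isPath v z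
      cases p with
      | nil => exact absurd rfl hz.1
      | @cons _ x _ hvx p =>
        rw [SimpleGraph.Walk.cons_isPath_iff] at hp
        obtain rfl : u = x := by
          obtain ⟨y, hy⟩ := Finset.card_eq_one.1 (hleaf v hv)
          have h1 : u ∈ G.neighborFinset v := by simpa using hu
          have h2 : x ∈ G.neighborFinset v := by simpa using hvx
          rw [hy, Finset.mem_singleton] at h1 h2
          rw [h1, h2]
        exact ⟨p, hp.2⟩
    have := Finset.card_le_card this
    rw [Finset.card_erase_of_mem hv] at this
    omega
  obtain ⟨⟨v, u⟩, hvu, hmin⟩ := P.exists_min_image (fun t => (branch G t.1 t.2).ncard) hPne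
  simp only [hP, Finset.mem_filter, Finset.mem_univ, true_and] at hvu hmin
  obtain ⟨hadj, hhalf⟩ := hvu
  set C := branch G v u with hC
  set K : Finset V := {x | G.Adj v x ∧ x ∈ C} with hK
  have memK : ∀ {x}, x ∈ K ↔ G.Adj v x ∧ x ∈ C := by simp [hK]
  set W : V → Finset V := fun x => G.neighborFinset x \ insert v K with hW
  have hWcard : ∀ x ∈ K, #(W x) + #K ≤ D := by
    intro x hx
    obtain ⟨hvx, hxC⟩ := memK.1 hx
    have hsub : insert v (K.erase x) ⊆ G.neighborFinset x := by
      intro y hy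
      rw [SimpleGraph.mem_neighborFinset]
      rcases Finset.mem_insert.1 hy with rfl | hy
      · exact hvx.symm
      · obtain ⟨hyx, hy⟩ := Finset.mem_erase.1 hy
        obtain ⟨hvy, hyC⟩ := memK.1 hy
        exact hG.adj_of_mem_branch hxC hyC hvx hvy hyx.symm
    have hvK : v ∉ K.erase x := fun h =>
      G.loopless.irrefl v (memK.1 (Finset.mem_of_mem_erase h)).1
    have hcard : #(insert v (K.erase x)) = #K := by
      rw [Finset.card_insert_of_notMem hvK, Finset.card_erase_add_one hx]
    have hdisj : Disjoint (W x) (insert v (K.erase x)) :=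
      Finset.sdiff_disjoint.mono_right (Finset.insert_subset_insert _ (Finset.erase_subset _ _))
    calc #(W x) + #K = #(W x ∪ insert v (K.erase x)) := by
          rw [Finset.card_union_of_disjoint hdisj, hcard]
      _ ≤ #(G.neighborFinset x) :=
          Finset.card_le_card (Finset.union_subset Finset.sdiff_subset hsub)
      _ ≤ D := by rw [G.card_neighborFinset_eq_degree]; exact G.degree_le_maxDegree x
  have hKbd : ∀ x ∈ K, x ∉ bd := by
    intro x hx hxbd
    obtain ⟨hvx, hxC⟩ := memK.1 hx
    obtain ⟨y, hy⟩ := Finset.card_eq_one.1 (hleaf x hxbd)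
    have huniq : ∀ t, G.Adj x t → t = v := by
      intro t ht
      have h1 : t ∈ G.neighborFinset x := by simpa using ht
      have h2 : v ∈ G.neighborFinset x := by simpa using hvx.symm
      rw [hy, Finset.mem_singleton] at h1 h2
      rw [h1, h2]
    have hsub : {z ∈ bd | z ∈ C} ⊆ {x} := by
      intro z hz
      obtain ⟨x', hx'C, hvx', h⟩ := exists_branch_of_mem_branch hG.1 (Finset.mem_filter.1 hz).2
      obtain rfl : x = x' := by
        by_contra hne
        exact hvx'.ne' (huniq x' (hG.adj_of_mem_branch hxC hx'C hvx hvx' hne))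
      rcases h with rfl | ⟨w, hxw, hwv, -⟩
      · simp
      · exact absurd (huniq w hxw) hwv
    have := Finset.card_le_card hsub
    rw [Finset.card_singleton] at this
    omega
  have hcover : {z ∈ bd | z ∈ C} ⊆
      (K.sigma W).biUnion fun t => {z ∈ bd | z ∈ branch G t.1 t.2} := by
    intro z hz
    obtain ⟨hzbd, hzC⟩ := Finset.mem_filter.1 hz
    obtain ⟨x, hxC, hvx, h⟩ := exists_branch_of_mem_branch hG.1 hzC
    have hxK : x ∈ K := memK.2 ⟨hvx, hxC⟩
    rcases h with rfl | ⟨w, hxw, hwv, hvw, hzw⟩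
    · exact absurd hzbd (hKbd z hxK)
    · refine Finset.mem_biUnion.2 ⟨⟨x, w⟩, Finset.mem_sigma.2 ⟨hxK, ?_⟩,
        Finset.mem_filter.2 ⟨hzbd, hzw⟩⟩
      simp [hW, hxw, hwv, memK, hvw]
  have hTne : (K.sigma W).Nonempty := by
    by_contra h
    rw [Finset.not_nonempty_iff_eq_empty] at h
    rw [h, Finset.biUnion_empty] at hcover
    have := Finset.card_le_card hcover
    rw [Finset.card_empty] at this
    omega
  obtain ⟨⟨x, w⟩, ht, hmax⟩ :=
    (K.sigma W).exists_max_image (fun t => #{z ∈ bd | z ∈ branch G t.1 t.2}) hTne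
  obtain ⟨hxK, hwW⟩ := Finset.mem_sigma.1 ht
  simp only at hxK hwW
  obtain ⟨hvx, hxC⟩ := memK.1 hxK
  have hwW' : G.Adj x w ∧ w ≠ v ∧ w ∉ K := by simpa [hW] using hwW
  obtain ⟨hxw, hwv, hwK⟩ := hwW'
  have hvw : ¬ G.Adj v w := fun h => hwK (memK.2 ⟨h, mem_branch_of_adj hxC hxw hwv⟩)
  have hvB : v ∉ branch G x w := hG.notMem_branch hvx hxw hwv hvw
  refine ⟨x, w, W x, #K, hWcard x hxK, ?_, ?_, ?_⟩
  · by_contra! h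
    have h1 := hmin (x, w) ⟨hxw, h⟩
    have h2 := Set.ncard_lt_ncard (branch_ssubset_branch hxC hxw hvB)
    exact h1.not_gt h2
  · set a := #{z ∈ bd | z ∈ branch G x w}
    have hTcard : #(K.sigma W) ≤ #K * (D - #K) := by
      rw [Finset.card_sigma, ← smul_eq_mul]
      exact Finset.sum_le_card_nsmul _ _ _ fun y hy => by have := hWcard y hy; omega
    have := calc #{z ∈ bd | z ∈ C}
        ≤ #(K.sigma W) * a :=
          (Finset.card_le_card hcover).trans (Finset.card_biUnion_le_card_mul _ _ _ hmax)
      _ ≤ #K * (D - #K) * a := Nat.mul_le_mul_right _ hTcard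
    calc #bd ≤ 2 * #{z ∈ bd | z ∈ C} := hhalf
      _ ≤ 2 * (#K * (D - #K) * a) := by gcongr
      _ = 2 * #K * (D - #K) * a := by ring
  · intro p q hpq hp hq
    have hqx : q = x := by
      by_contra h
      exact hq (mem_branch_of_adj hp hpq h)
    subst hqx
    refine ⟨rfl, ?_⟩
    have hpv : p ≠ v := fun h => hvB (h ▸ hp)
    have hpK : p ∉ K := fun h => hvB (mem_branch_of_adj hp (memK.1 h).1.symm hvx.ne)
    simp [hW, hpq.symm, hpv, hpK]

/-- For a block graph with maximum degree `D`, the maximum block size `B` satisfies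
`B ≤ D + 1`, and consequently `λ₂ ≤ (D + 1)² (D - 1) / |δΩ|`. -/
theorem lambda2_block_graph_deg' [Fintype V] (G : SimpleGraph V) [DecidableRel G.Adj]
    (bd : Finset V) (D Bk : ℕ)
    (hblock : IsBlockGraph G) (hV : 3 ≤ Fintype.card V)
    (hleaf : ∀ x ∈ bd, G.degree x = 1) (hbd : 2 ≤ bd.card)
    (hD : G.maxDegree = D)
    (hBk : ∀ S : Set V, IsBlockOf G S → S.ncard ≤ Bk)
    (hBk' : ∃ S : Set V, IsBlockOf G S ∧ S.ncard = Bk) :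
    Bk ≤ D + 1 ∧
      steklovLambda2 G bd ≤ ((D : ℝ) + 1) ^ 2 * ((D : ℝ) - 1) / bd.card := by
  classical
  obtain ⟨S, hS, rfl⟩ := hBk'
  subst hD
  refine ⟨hS.ncard_le hblock, ?_⟩
  have hD2 : (2 : ℝ) ≤ G.maxDegree := by exact_mod_cast two_le_maxDegree hblock.1 hV
  set D := G.maxDegree
  rcases hbd.eq_or_lt with hbd2 | hbd3
  · obtain ⟨x, hx⟩ : bd.Nonempty := Finset.card_pos.1 (by omega)
    obtain ⟨v, hv⟩ := Finset.card_eq_one.1 (hleaf x hx)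
    have hcard : #{z ∈ bd | z ∈ ({x} : Set V)} = 1 := by
      rw [Finset.card_eq_one]
      refine ⟨x, ?_⟩
      ext z
      simp only [Finset.mem_filter, Set.mem_singleton_iff, Finset.mem_singleton]
      exact ⟨fun h => h.2, fun h => ⟨h ▸ hx, h⟩⟩
    have h := steklovLambda2_le_of_cut G bd {x} v {x} (by
      rintro p q hpq rfl -
      refine ⟨?_, Finset.mem_singleton_self _⟩
      have : q ∈ G.neighborFinset p := by simpa using hpq
      rwa [hv, Finset.mem_singleton] at this) (by omega) (by omega)
    rw [hcard, ← hbd2] at h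
    rw [← hbd2]
    norm_num at h ⊢
    nlinarith [mul_nonneg (sq_nonneg ((D : ℝ) + 1)) (sub_nonneg.2 hD2)]
  · obtain ⟨x, w, N, k, hNk, hhalf, hshare, hcut⟩ := hblock.exists_branch hleaf hbd3
    set a := #{z ∈ bd | z ∈ branch G x w} with ha
    have ha0 : 0 < a := by
      rcases Nat.eq_zero_or_pos a with h | h
      · rw [h, mul_zero] at hshare; omega
      · exact h
    refine (steklovLambda2_le_of_cut G bd _ x N hcut ha0 (by omega)).trans ?_
    rw [← ha]
    obtain ⟨m, hm⟩ : ∃ m, m = G.maxDegree - k := ⟨_, rfl⟩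
    rw [← hm] at hshare
    have hNm : (#N : ℝ) ≤ m := by exact_mod_cast (by omega : #N ≤ m)
    have hmk : (m : ℝ) + k ≤ D := by exact_mod_cast (by omega : m + k ≤ G.maxDegree)
    have hhalf' : 2 * (a : ℝ) < #bd := by exact_mod_cast hhalf
    have hshare' : (#bd : ℝ) ≤ 2 * k * m * a := by exact_mod_cast hshare
    have hmain := four_mul_mul_sq_le (Nat.cast_nonneg k) (Nat.cast_nonneg m) hmk hD2
    have ha0' : (0 : ℝ) < a := by exact_mod_cast ha0
    have hn0 : (0 : ℝ) < #bd := by linarith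
    rw [div_le_div_iff₀ (mul_pos ha0' (by linarith)) hn0]
    calc (#N : ℝ) * #bd * #bd ≤ m * #bd * (2 * k * m * a) := by gcongr
      _ = 4 * k * m ^ 2 * (a * (#bd / 2)) := by ring
      _ ≤ (D + 1) ^ 2 * (D - 1) * (a * (#bd - a)) := by
        have : (0 : ℝ) ≤ (D + 1) ^ 2 * (D - 1) := le_trans (by positivity) hmain
        gcongr
        linarith
end

section
/- Let G = (V, E) be a tree with |V| ≥ 3, with the set of all its leaves as boundary δΩ, and let D be the maximum degree of G. Then λ₂(G, δΩ) ≤ 4 (D − 1) / |δΩ|. -/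
open Finset

variable {V : Type*}

namespace SimpleGraph

/-- In a tree, the neighbour of `w` closer to `x` is unique. -/
lemma IsTree.eq_of_adj_of_dist_lt {G : SimpleGraph V} (hT : G.IsTree) {x w u y : V}
    (hu : G.Adj w u) (hy : G.Adj w y) (hxu : G.dist x u < G.dist x w)
    (hxy : G.dist x y < G.dist x w) : u = y := by
  have key (z : V) (hz : G.Adj w z) (hxz : G.dist x z < G.dist x w) :
      ∃ p : G.Walk z x, (Walk.cons hz p).IsPath := by
    obtain ⟨p, hp⟩ := hT.connected.exists_walk_length_eq_dist z x
    refine ⟨p, Walk.isPath_of_length_eq_dist _ ?_⟩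
    have h := hT.dist_eq_dist_add_one_of_adj x hz
    rw [Walk.length_cons, hp, dist_comm, dist_comm (u := w)]
    omega
  obtain ⟨p, hp⟩ := key u hu hxu
  obtain ⟨q, hq⟩ := key y hy hxy
  have h := congrArg Walk.snd ((hT.existsUnique_path w x).unique hp hq)
  simpa using h

lemma IsTree.exists_adj_dist_lt {G : SimpleGraph V} (hT : G.IsTree) {x w : V} (h : x ≠ w) :
    ∃ y, G.Adj w y ∧ G.dist x y < G.dist x w := by
  obtain ⟨p, hp⟩ := hT.connected.exists_walk_length_eq_dist w x
  cases p with
  | nil => exact absurd rfl h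
  | cons hy q =>
    refine ⟨_, hy, ?_⟩
    have := dist_le q
    rw [Walk.length_cons] at hp
    rw [dist_comm, dist_comm (u := x) (v := w)]
    omega

/-- If an edge `p q` of a tree joins the two sides of the edge `u w`, then `p q` is `u w`. -/
lemma IsTree.eq_of_adj_of_dist_lt_of_dist_lt {G : SimpleGraph V} (hT : G.IsTree) {u w p q : V}
    (huw : G.Adj u w) (hpq : G.Adj p q) (hp : G.dist p w < G.dist p u)
    (hq : G.dist q u < G.dist q w) : p = w ∧ q = u := by
  have h1 := hT.dist_eq_dist_add_one_of_adj p huw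
  have h2 := hT.dist_eq_dist_add_one_of_adj q huw
  have h3 := hT.dist_eq_dist_add_one_of_adj u hpq
  have h4 := hT.dist_eq_dist_add_one_of_adj w hpq
  simp only [dist_comm (u := u) (v := p), dist_comm (u := u) (v := q),
    dist_comm (u := w) (v := p), dist_comm (u := w) (v := q)] at h3 h4
  have hpw : p = w := by
    by_contra hne
    obtain ⟨p', hp', hlt⟩ := hT.exists_adj_dist_lt (x := w) (w := p) (Ne.symm hne)
    have h5 := hT.connected.dist_triangle (u := p') (v := w) (w := u)
    have h6 : G.dist w u = 1 := dist_eq_one_iff_adj.2 huw.symm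
    simp only [dist_comm (u := w) (v := p), dist_comm (u := w) (v := p')] at hlt
    have : p' = q := by
      refine hT.eq_of_adj_of_dist_lt (x := u) hp' hpq ?_ ?_ <;>
        simp only [dist_comm (u := u)] <;> omega
    subst this
    omega
  subst hpw
  refine ⟨rfl, (hT.connected.dist_eq_zero_iff).1 ?_⟩
  simp only [dist_self] at *
  omega

/-- The vertices lying on the side of `w` with respect to the edge `u w`. -/
noncomputable def branch [Fintype V] (G : SimpleGraph V) (u w : V) : Finset V :=
  {x | G.dist x w < G.dist x u}

lemma mem_branch [Fintype V] {G : SimpleGraph V} {u w x : V} :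
    x ∈ G.branch u w ↔ G.dist x w < G.dist x u := by
  simp [branch]

lemma IsTree.compl_branch [Fintype V] [DecidableEq V] {G : SimpleGraph V} (hT : G.IsTree)
    {u w : V} (huw : G.Adj u w) : (G.branch u w)ᶜ = G.branch w u := by
  ext x
  have := hT.dist_ne_of_adj x huw
  simp only [mem_compl, mem_branch]
  omega

lemma IsTree.branch_ssubset_branch [Fintype V] {G : SimpleGraph V} (hT : G.IsTree) {u w y : V}
    (huw : G.Adj u w) (hwy : G.Adj w y) (hne : y ≠ u) : G.branch w y ⊂ G.branch u w := by
  refine (ssubset_iff_of_subset fun x hx => ?_).2 ⟨w, ?_, ?_⟩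
  · rw [mem_branch] at hx ⊢
    have := hT.dist_ne_of_adj x huw
    by_contra h
    exact hne (hT.eq_of_adj_of_dist_lt hwy huw.symm hx (by omega))
  · simp [mem_branch, dist_eq_one_iff_adj.2 huw.symm]
  · simp [mem_branch]

lemma IsTree.branch_subset [Fintype V] [DecidableEq V] {G : SimpleGraph V} [DecidableRel G.Adj]
    (hT : G.IsTree) (u w : V) :
    G.branch u w ⊆ insert w (((G.neighborFinset w).erase u).biUnion (G.branch w)) := by
  intro x hx
  rw [mem_insert, or_iff_not_imp_left]
  intro hxw
  obtain ⟨y, hy, hlt⟩ := hT.exists_adj_dist_lt hxw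
  rw [mem_branch] at hx
  refine mem_biUnion.2 ⟨y, ?_, mem_branch.2 hlt⟩
  rw [mem_erase, mem_neighborFinset]
  refine ⟨?_, hy⟩
  rintro rfl
  omega

lemma Connected.two_le_maxDegree [Fintype V] {G : SimpleGraph V}
    [DecidableRel G.Adj] (hG : G.Connected) (hV : 3 ≤ Fintype.card V) : 2 ≤ G.maxDegree := by
  classical
  have h1 := hG.card_vert_le_card_edgeSet_add_one
  have h2 := G.sum_degrees_eq_twice_card_edges
  have h3 : ∑ v, G.degree v ≤ Fintype.card V * G.maxDegree := by
    simpa using sum_le_card_nsmul univ (fun v => G.degree v) G.maxDegree fun v _ => G.degree_le_maxDegree v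
  rw [Nat.card_eq_fintype_card, Nat.card_eq_fintype_card, ← edgeFinset_card] at h1
  by_contra! h
  nlinarith

end SimpleGraph

open SimpleGraph

lemma graphEnergy_nonneg [Fintype V] (G : SimpleGraph V) (f : V → ℝ) : 0 ≤ graphEnergy G f := by
  refine sum_nonneg fun e _ => ?_
  induction e with
  | _ x y => exact sq_nonneg _

lemma steklovLambda2_le [Fintype V] (G : SimpleGraph V) (B : Finset V) (f : V → ℝ)
    (h0 : ∑ x ∈ B, f x = 0) (h1 : ∃ x ∈ B, f x ≠ 0) :
    steklovLambda2 G B ≤ graphEnergy G f / ∑ x ∈ B, f x ^ 2 := by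
  refine csInf_le ⟨0, ?_⟩ ⟨f, h0, h1, rfl⟩
  rintro r ⟨g, -, -, rfl⟩
  exact div_nonneg (graphEnergy_nonneg G g) (sum_nonneg fun _ _ => sq_nonneg _)

/-- The energy of a function taking constant values on each side of an edge of a tree. -/
lemma SimpleGraph.IsTree.graphEnergy_branch [Fintype V] [DecidableEq V] {G : SimpleGraph V}
    (hT : G.IsTree) {u w : V} (huw : G.Adj u w) (s t : ℝ) :
    graphEnergy G (fun x => if x ∈ G.branch u w then s else t) = (s - t) ^ 2 := by
  have hw : w ∈ G.branch u w := by simp [mem_branch, dist_eq_one_iff_adj.2 huw.symm]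
  have hu : u ∉ G.branch u w := by simp [mem_branch]
  rw [graphEnergy, sum_eq_single s(u, w)]
  · simp only [Sym2.lift_mk, hw, hu, if_true, if_false]
    ring
  · intro e he hne
    induction e with
    | _ p q =>
    simp only [Set.Finite.mem_toFinset, mem_edgeSet] at he
    simp only [Sym2.lift_mk]
    have key (p q : V) (hpq : G.Adj p q) (hne : s(p, q) ≠ s(u, w)) (hp : p ∈ G.branch u w) :
        q ∈ G.branch u w := by
      by_contra hq
      rw [← mem_compl, hT.compl_branch huw, mem_branch] at hq
      obtain ⟨rfl, rfl⟩ := hT.eq_of_adj_of_dist_lt_of_dist_lt huw hpq (mem_branch.1 hp) hq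
      exact hne Sym2.eq_swap
    have h : p ∈ G.branch u w ↔ q ∈ G.branch u w :=
      ⟨key p q he hne, key q p he.symm (by rwa [Sym2.eq_swap])⟩
    simp [h]
  · intro h
    simp [huw] at h

/-- Cutting an edge of a tree bounds the first Steklov eigenvalue. -/
lemma SimpleGraph.IsTree.steklovLambda2_le_of_adj [Fintype V] [DecidableEq V] {G : SimpleGraph V}
    (hT : G.IsTree) (B : Finset V) {u w : V} (huw : G.Adj u w) {a b : ℕ}
    (ha : #(B ∩ G.branch u w) = a) (hb : #(B ∩ G.branch w u) = b) (ha0 : 0 < a) (hb0 : 0 < b) :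
    steklovLambda2 G B ≤ ((a : ℝ) + b) / (a * b) := by
  have hsum (s t : ℝ) : ∑ x ∈ B, (if x ∈ G.branch u w then s else t) = a * s + b * t := by
    rw [sum_ite, sum_const, sum_const, filter_mem_eq_inter, ha]
    have : {x ∈ B | x ∉ G.branch u w} = B ∩ G.branch w u := by
      ext x
      simp [← hT.compl_branch huw]
    rw [this, hb, nsmul_eq_mul, nsmul_eq_mul]
  have ha' : (0 : ℝ) < a := by exact_mod_cast ha0
  have hb' : (0 : ℝ) < b := by exact_mod_cast hb0
  have h := steklovLambda2_le G B (fun x => if x ∈ G.branch u w then (b : ℝ) else -a)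
    (by rw [hsum]; ring) ?_
  · refine h.trans_eq ?_
    rw [hT.graphEnergy_branch huw]
    simp only [ite_pow]
    rw [hsum]
    field_simp
    ring
  · rw [← ha, card_pos] at ha0
    obtain ⟨x, hx⟩ := ha0
    rw [mem_inter] at hx
    exact ⟨x, hx.1, by simp [hx.2, hb'.ne']⟩

/-- A tree has an edge splitting its set of leaves in a balanced way. -/
lemma SimpleGraph.IsTree.exists_adj_balanced [Fintype V] [DecidableEq V] {G : SimpleGraph V}
    [DecidableRel G.Adj] (hT : G.IsTree) (hV : 3 ≤ Fintype.card V) {B : Finset V}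
    (hB : ∀ x, x ∈ B ↔ G.degree x = 1) :
    ∃ u w a b, G.Adj u w ∧ #(B ∩ G.branch u w) = a ∧ #(B ∩ G.branch w u) = b ∧ a + b = #B ∧
      0 < a ∧ #B ≤ 2 * b ∧ #B ≤ 2 * (a * (G.maxDegree - 1)) := by
  have hD := hT.connected.two_le_maxDegree hV
  have : Nontrivial V := Fintype.one_lt_card_iff_nontrivial.1 (by omega)
  obtain ⟨v₁, v₂, hne, hv₁, hv₂⟩ := hT.exists_ne_and_degree_eq_one
  have hB2 : 1 < #B := one_lt_card.2
    ⟨v₁, (hB _).2 (by convert hv₁), v₂, (hB _).2 (by convert hv₂), hne⟩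
  have hadd (u w : V) (huw : G.Adj u w) :
      #(B ∩ G.branch u w) + #(B ∩ G.branch w u) = #B := by
    rw [← hT.compl_branch huw, ← sdiff_eq_inter_compl, card_inter_add_card_sdiff]
  obtain ⟨⟨u, w⟩, hd, hmin⟩ := exists_min_image
    {d : V × V | G.Adj d.1 d.2 ∧ #B ≤ 2 * #(B ∩ G.branch d.1 d.2)}
    (fun d => #(G.branch d.1 d.2)) (by
      obtain ⟨z, hz⟩ := hT.connected.preconnected.exists_adj_of_nontrivial v₁
      have := hadd v₁ z hz
      by_cases h : #B ≤ 2 * #(B ∩ G.branch v₁ z)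
      · exact ⟨(v₁, z), by simp [hz, h]⟩
      · exact ⟨(z, v₁), by simp only [mem_filter_univ]; exact ⟨hz.symm, by omega⟩⟩)
  simp only [mem_filter_univ, Prod.forall] at hd hmin
  obtain ⟨huw, hhalf⟩ := hd
  have hcard : #((G.neighborFinset w).erase u) = G.degree w - 1 := by
    rw [card_erase_of_mem (by simpa using huw.symm), card_neighborFinset_eq_degree]
  have hsub := hT.branch_subset u w
  by_cases hw : G.degree w = 1
  · rw [hw, Nat.sub_self, card_eq_zero] at hcard
    rw [hcard, biUnion_empty] at hsub
    have h1 : #(B ∩ G.branch u w) ≤ 1 :=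
      (card_le_card (inter_subset_right.trans hsub)).trans (by simp)
    have h2 := hadd u w huw
    refine ⟨w, u, _, _, huw.symm, rfl, rfl, by omega, by omega, by omega, ?_⟩
    have h3 : #(B ∩ G.branch w u) = 1 := by omega
    rw [h3]
    omega
  · have hsum : #(B ∩ G.branch u w) ≤
        ∑ y ∈ (G.neighborFinset w).erase u, #(B ∩ G.branch w y) := by
      refine (card_le_card fun x hx => ?_).trans card_biUnion_le
      rw [mem_inter] at hx
      have hxw : x ≠ w := by
        rintro rfl
        exact hw ((hB _).1 hx.1)
      obtain ⟨y, hy, hxy⟩ := mem_biUnion.1 (mem_of_mem_insert_of_ne (hsub hx.2) hxw)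
      exact mem_biUnion.2 ⟨y, hy, mem_inter.2 ⟨hx.1, hxy⟩⟩
    have hne : ((G.neighborFinset w).erase u).Nonempty := by
      by_contra h
      rw [not_nonempty_iff_eq_empty] at h
      rw [h, sum_empty] at hsum
      omega
    obtain ⟨y, hy, hmax⟩ := exists_max_image _ (fun y => #(B ∩ G.branch w y)) hne
    have h1 := sum_le_card_nsmul _ _ _ hmax
    rw [hcard, smul_eq_mul] at h1
    have h2 : (G.degree w - 1) * #(B ∩ G.branch w y) ≤
        #(B ∩ G.branch w y) * (G.maxDegree - 1) := by
      rw [mul_comm]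
      exact Nat.mul_le_mul_left _ (Nat.sub_le_sub_right (G.degree_le_maxDegree w) 1)
    rw [mem_erase, mem_neighborFinset] at hy
    have h3 := card_lt_card (hT.branch_ssubset_branch huw hy.2 hy.1)
    have h4 : ¬ #B ≤ 2 * #(B ∩ G.branch w y) := fun h => by
      have := hmin w y ⟨hy.2, h⟩
      omega
    have h5 := hadd w y hy.2
    refine ⟨w, y, _, _, hy.2, rfl, rfl, h5, ?_, by omega, by omega⟩
    by_contra! h
    rw [Nat.le_zero.1 h] at h1 h2
    omega

/-- For a tree with the set of all its leaves as boundary and maximum degree `D`,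
`λ₂ ≤ 4 (D - 1) / |δΩ|`. -/
theorem lambda2_tree_deg [Fintype V] [DecidableEq V] (G : SimpleGraph V) [DecidableRel G.Adj]
    (hT : G.IsTree) (hV : 3 ≤ Fintype.card V) (D : ℕ) (hD : G.maxDegree = D) :
    steklovLambda2 G ({x : V | G.degree x = 1} : Finset V) ≤
      4 * ((D : ℝ) - 1) / ({x : V | G.degree x = 1} : Finset V).card := by
  subst hD
  obtain ⟨u, w, a, b, huw, ha, hb, hab, ha0, h1, h2⟩ :=
    hT.exists_adj_balanced hV (B := {x : V | G.degree x = 1}) (by simp)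
  have hb0 : 0 < b := by omega
  have hD := hT.connected.two_le_maxDegree hV
  refine (hT.steklovLambda2_le_of_adj _ huw ha hb ha0 hb0).trans ?_
  rw [← hab] at h1 h2 ⊢
  have ha' : (0 : ℝ) < a := by exact_mod_cast ha0
  have hb' : (0 : ℝ) < b := by exact_mod_cast hb0
  have h1' : (a + b : ℝ) ≤ 2 * b := by exact_mod_cast h1
  have h2' : (a + b : ℝ) ≤ 2 * (a * ((G.maxDegree : ℝ) - 1)) := by
    rw [← Nat.cast_pred (by omega)]
    exact_mod_cast h2
  push_cast
  rw [div_le_div_iff₀ (by positivity) (by positivity)]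
  have := mul_le_mul h1' h2' (by positivity) (by positivity)
  linarith
end
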